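/- arXiv:1704.00941 — 2 statements merged into one kernel-verified Lean document; each statement's English description precedes it below -/
import Mathlib

section
/- Let G be a finite simple undirected graph on n ≥ 2 vertices with at least one edge, let L = D − A be its Laplacian matrix, let Δ(G) be the maximum vertex degree, and let λ_n be the largest eigenvalue of L. Then (n/(n−1)) Δ(G) ≤ λ_n ≤ 2 Δ(G). -/
open Matrix

/-- The Rayleigh quotient of a real symmetric matrix is at most any upper bound of its
eigenvalues. -/
theorem Matrix.IsHermitian.dotProduct_mulVec_le {V : Type*} [Fintype V] [DecidableEq V]
    {A : Matrix V V ℝ} (hA : A.IsHermitian) {μ : ℝ}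
    (hmax : ∀ ν : ℝ, (∃ v : V → ℝ, v ≠ 0 ∧ A.mulVec v = ν • v) → ν ≤ μ) (x : V → ℝ) :
    x ⬝ᵥ A.mulVec x ≤ μ * (x ⬝ᵥ x) := by
  have hB : (μ • (1 : Matrix V V ℝ) - A).IsHermitian :=
    (isHermitian_one.smul (IsSelfAdjoint.all μ)).sub hA
  have hpos : (μ • (1 : Matrix V V ℝ) - A).PosSemidef := by
    rw [hB.posSemidef_iff_eigenvalues_nonneg]
    intro i
    have hw := hB.mulVec_eigenvectorBasis i
    rw [sub_mulVec, smul_mulVec, one_mulVec] at hw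
    have hle := hmax (μ - hB.eigenvalues i)
      ⟨⇑(hB.eigenvectorBasis i), fun h0 => hB.eigenvectorBasis.orthonormal.ne_zero i
        (by ext j; exact congrFun h0 j), by rw [sub_smul, ← hw, sub_sub_cancel]⟩
    simpa using hle
  have h := hpos.dotProduct_mulVec_nonneg x
  rw [star_trivial, sub_mulVec, smul_mulVec, one_mulVec, dotProduct_sub, dotProduct_smul,
    smul_eq_mul] at h
  linarith

namespace SimpleGraph

variable {V : Type*} [Fintype V] [DecidableEq V] (G : SimpleGraph V) [DecidableRel G.Adj]

/-- The Laplacian quadratic form at `c • eᵢ - 1`. -/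
theorem dotProduct_lapMatrix_mulVec_single_sub_one (i : V) (c : ℝ) :
    (Pi.single i c - 1) ⬝ᵥ (G.lapMatrix ℝ).mulVec (Pi.single i c - 1) = c ^ 2 * G.degree i := by
  have h1 : (G.lapMatrix ℝ).mulVec 1 = 0 := G.lapMatrix_mulVec_const_eq_zero
  have h2 : Matrix.vecMul 1 (G.lapMatrix ℝ) = 0 := by
    rw [← Matrix.mulVec_transpose, (G.isSymm_lapMatrix (R := ℝ)).eq, h1]
  rw [Matrix.mulVec_sub, h1, sub_zero, sub_dotProduct, Matrix.dotProduct_mulVec 1, h2,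
    zero_dotProduct, sub_zero, single_dotProduct, lapMatrix_mulVec_apply]
  have h3 : ∑ u ∈ G.neighborFinset i, (Pi.single i c : V → ℝ) u = 0 :=
    Finset.sum_eq_zero fun u hu =>
      Pi.single_eq_of_ne (G.ne_of_adj ((G.mem_neighborFinset i u).1 hu)).symm _
  rw [h3, Pi.single_eq_same]
  ring

/-- Every Laplacian eigenvalue is at most twice the maximum degree. -/
theorem le_two_mul_maxDegree_of_lapMatrix_mulVec_eq_smul {μ : ℝ} {v : V → ℝ} (hv : v ≠ 0)
    (h : (G.lapMatrix ℝ).mulVec v = μ • v) : μ ≤ 2 * G.maxDegree := by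
  obtain ⟨j, hj⟩ := Function.ne_iff.1 hv
  obtain ⟨i, -, hi⟩ := Finset.exists_max_image Finset.univ (fun k => |v k|) ⟨j, Finset.mem_univ j⟩
  have hpos : 0 < |v i| := (abs_pos.2 hj).trans_le (hi j (Finset.mem_univ j))
  have heq := congrFun h i
  rw [lapMatrix_mulVec_apply, Pi.smul_apply, smul_eq_mul] at heq
  have hsum : |∑ u ∈ G.neighborFinset i, v u| ≤ G.degree i * |v i| := by
    refine (Finset.abs_sum_le_sum_abs _ _).trans ?_
    rw [← G.card_neighborFinset_eq_degree, ← nsmul_eq_mul]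
    exact Finset.sum_le_card_nsmul _ _ _ fun u _ => hi u (Finset.mem_univ u)
  have hdeg : (G.degree i : ℝ) ≤ G.maxDegree := mod_cast G.degree_le_maxDegree i
  have habs : μ * |v i| ≤ 2 * G.degree i * |v i| := calc
    μ * |v i| ≤ |μ * v i| := by rw [abs_mul]; gcongr; exact le_abs_self μ
    _ ≤ |G.degree i * v i| + |∑ u ∈ G.neighborFinset i, v u| := by
      rw [← heq]; exact abs_sub _ _
    _ ≤ 2 * G.degree i * |v i| := by rw [abs_mul, Nat.abs_cast]; linarith
  linarith [le_of_mul_le_mul_right habs hpos]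

end SimpleGraph

/-- for a finite simple graph on `n ≥ 2` vertices with at least one edge,
the largest Laplacian eigenvalue `μ` satisfies `(n/(n-1)) Δ(G) ≤ μ ≤ 2 Δ(G)`. -/
theorem stmt_17 {n : ℕ} (hn : 2 ≤ n) (G : SimpleGraph (Fin n)) [DecidableRel G.Adj]
    (hedge : ∃ u v : Fin n, G.Adj u v)
    (μ : ℝ)
    (hμ : ∃ v : Fin n → ℝ, v ≠ 0 ∧ (G.lapMatrix ℝ).mulVec v = μ • v)
    (hmax : ∀ ν : ℝ, (∃ v : Fin n → ℝ, v ≠ 0 ∧ (G.lapMatrix ℝ).mulVec v = ν • v) → ν ≤ μ) :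
    ((n : ℝ) / ((n : ℝ) - 1)) * (G.maxDegree : ℝ) ≤ μ ∧ μ ≤ 2 * (G.maxDegree : ℝ) := by
  obtain ⟨v, hv, hLv⟩ := hμ
  refine ⟨?_, G.le_two_mul_maxDegree_of_lapMatrix_mulVec_eq_smul hv hLv⟩
  obtain ⟨u, -, -⟩ := hedge
  have : Nonempty (Fin n) := ⟨u⟩
  obtain ⟨i, hi⟩ := G.exists_maximal_degree_vertex
  have hR := (G.isHermitian_lapMatrix (R := ℝ)).dotProduct_mulVec_le hmax
    (Pi.single i (n : ℝ) - 1)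
  have hnorm : (Pi.single i (n : ℝ) - 1 : Fin n → ℝ) ⬝ᵥ (Pi.single i (n : ℝ) - 1)
      = n * (n - 1) := by
    simp [sub_dotProduct, dotProduct_sub]
    ring
  rw [G.dotProduct_lapMatrix_mulVec_single_sub_one, hnorm, ← hi] at hR
  have hn' : (2 : ℝ) ≤ n := mod_cast hn
  rw [div_mul_eq_mul_div, div_le_iff₀ (by linarith)]
  exact le_of_mul_le_mul_left (by linarith) (by linarith : (0 : ℝ) < n)
end

section
/- Let G be a finite connected simple undirected graph on n vertices with Laplacian matrix L, let λ_n be the largest eigenvalue of L, and let α be a real number with 0 < α < 2/λ_n. Set W = I − αL. Then for every initial vector x(0) ∈ ℝⁿ, the consensus iteration x(t+1) = W x(t) converges: lim_{t→∞} W^t x(0) = m̄ 𝟏, where m̄ = (1/n) Σ_{k=1}^n x_k(0) and 𝟏 is the all-ones vector. -/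
open Matrix Filter

/-- The powers of a Hermitian matrix converge pointwise if all eigenvalues lie in `(-1, 1]`. -/
theorem exists_tendsto_pow_mulVec {ι : Type*} [Fintype ι] [DecidableEq ι] {A : Matrix ι ι ℝ}
    (hA : A.IsHermitian)
    (h : ∀ κ : ℝ, ∀ v : ι → ℝ, v ≠ 0 → A.mulVec v = κ • v → -1 < κ ∧ κ ≤ 1) (x : ι → ℝ) :
    ∃ y : ι → ℝ, Tendsto (fun t : ℕ => (A ^ t).mulVec x) atTop (nhds y) := by
  set b := hA.eigenvectorBasis with hb
  have hpow (t : ℕ) (j : ι) : (A ^ t).mulVec (b j).ofLp = hA.eigenvalues j ^ t • (b j).ofLp := by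
    induction t with
    | zero => simp
    | succ t ih =>
      rw [pow_succ, ← mulVec_mulVec, hb, hA.mulVec_eigenvectorBasis, mulVec_smul, ← hb, ih,
        smul_smul, pow_succ, mul_comm]
  have hx : x = ∑ j, b.repr (WithLp.toLp 2 x) j • (b j).ofLp := by
    have := congrArg WithLp.ofLp (b.sum_repr (WithLp.toLp 2 x))
    simpa [WithLp.ofLp_sum] using this.symm
  have hscalar (j : ι) : ∃ l : ℝ, Tendsto (fun t : ℕ => hA.eigenvalues j ^ t) atTop (nhds l) := by
    have hne : (b j).ofLp ≠ 0 := fun h0 =>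
      b.orthonormal.ne_zero j ((WithLp.ofLp_eq_zero 2).1 h0)
    obtain ⟨h1, h2⟩ := h _ _ hne (hA.mulVec_eigenvectorBasis j)
    rcases h2.eq_or_lt with h2 | h2
    · exact ⟨1, by simp [h2]⟩
    · exact ⟨0, tendsto_pow_atTop_nhds_zero_of_abs_lt_one (abs_lt.2 ⟨h1, h2⟩)⟩
  choose l hl using hscalar
  refine ⟨∑ j, b.repr (WithLp.toLp 2 x) j • l j • (b j).ofLp, ?_⟩
  have hsum (t : ℕ) : (A ^ t).mulVec x =
      ∑ j, b.repr (WithLp.toLp 2 x) j • hA.eigenvalues j ^ t • (b j).ofLp := by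
    conv_lhs => rw [hx]
    simp only [mulVec_sum, mulVec_smul, hpow]
  simp only [hsum]
  exact tendsto_finsetSum _ fun j _ => ((hl j).smul_const _).const_smul _

/-- for a connected graph with Laplacian `L` and largest Laplacian
eigenvalue `μ`, the consensus iteration `x(t+1) = (I - αL) x(t)` with `0 < α < 2/μ`
converges to the average consensus `m̄ 𝟏`. -/
theorem stmt_18 {n : ℕ} (G : SimpleGraph (Fin n)) [DecidableRel G.Adj]
    (hconn : G.Connected)
    (μ : ℝ)
    (hμ : ∃ v : Fin n → ℝ, v ≠ 0 ∧ (G.lapMatrix ℝ).mulVec v = μ • v)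
    (hmax : ∀ ν : ℝ, (∃ v : Fin n → ℝ, v ≠ 0 ∧ (G.lapMatrix ℝ).mulVec v = ν • v) → ν ≤ μ)
    (α : ℝ) (hα : 0 < α) (hα' : α < 2 / μ)
    (W : Matrix (Fin n) (Fin n) ℝ) (hW : W = 1 - α • G.lapMatrix ℝ) :
    ∀ x0 : Fin n → ℝ,
      Tendsto (fun t : ℕ => (W ^ t).mulVec x0) atTop
        (nhds (fun _ : Fin n => (∑ k : Fin n, x0 k) / (n : ℝ))) := by
  intro x0
  have hμ0 : 0 < μ := by
    by_contra! hle
    exact (hα.trans hα').not_ge (div_nonpos_of_nonneg_of_nonpos zero_le_two hle)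
  have hαμ : α * μ < 2 := (lt_div_iff₀ hμ0).1 hα'
  have hWv (v : Fin n → ℝ) : W.mulVec v = v - α • (G.lapMatrix ℝ).mulVec v := by
    rw [hW, sub_mulVec, one_mulVec, smul_mulVec]
  have hherm : W.IsHermitian := by
    rw [hW]
    refine isHermitian_one.sub ?_
    rw [IsHermitian, conjTranspose_smul, G.isHermitian_lapMatrix ℝ, star_trivial]
  obtain ⟨y, hy⟩ := exists_tendsto_pow_mulVec hherm (fun κ v hv hκ => by
    have hL : (G.lapMatrix ℝ).mulVec v = ((1 - κ) / α) • v := by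
      have h1 : α • (G.lapMatrix ℝ).mulVec v = (1 - κ) • v := by
        rw [hWv] at hκ
        rw [sub_smul, one_smul, ← hκ, sub_sub_cancel]
      rw [div_eq_inv_mul, mul_smul, ← h1, inv_smul_smul₀ hα.ne']
    have hle := hmax _ ⟨v, hv, hL⟩
    have hnn := (G.posSemidef_lapMatrix ℝ).dotProduct_mulVec_nonneg v
    rw [hL, star_trivial, dotProduct_smul, smul_eq_mul] at hnn
    have hvv : 0 < v ⬝ᵥ v := by simpa using dotProduct_star_self_pos_iff.2 hv
    have h0 := nonneg_of_mul_nonneg_left hnn hvv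
    rw [div_le_iff₀ hα] at hle
    have h1 : 0 ≤ 1 - κ := by simpa [hα.ne'] using mul_nonneg h0 hα.le
    constructor <;> linarith) x0
  have hfix : W.mulVec y = y := by
    have h1 : Tendsto (fun t : ℕ => W.mulVec ((W ^ t).mulVec x0)) atTop (nhds (W.mulVec y)) :=
      ((continuous_const.matrix_mulVec continuous_id).tendsto y).comp hy
    simp only [mulVec_mulVec, ← pow_succ'] at h1
    exact tendsto_nhds_unique h1 (hy.comp (tendsto_add_atTop_nat 1))
  have hker : (G.lapMatrix ℝ).mulVec y = 0 := by
    rw [hWv, sub_eq_self] at hfix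
    exact (smul_eq_zero.1 hfix).resolve_left hα.ne'
  have hconst := G.lapMatrix_mulVec_eq_zero_iff_forall_reachable.1 hker
  have hone : (fun _ => 1 : Fin n → ℝ) ᵥ* W = fun _ => 1 := by
    rw [← mulVec_transpose, ← conjTranspose_eq_transpose_of_trivial, hherm.eq, hWv,
      G.lapMatrix_mulVec_const_eq_zero, smul_zero, sub_zero]
  have hsum (t : ℕ) : ∑ k, (W ^ t).mulVec x0 k = ∑ k, x0 k := by
    induction t with
    | zero => simp
    | succ t ih =>
      rw [← ih, pow_succ', ← mulVec_mulVec]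
      simpa [dotProduct, hone] using
        dotProduct_mulVec (fun _ => 1 : Fin n → ℝ) W ((W ^ t).mulVec x0)
  have hysum : ∑ k, y k = ∑ k, x0 k := by
    have h1 := tendsto_finsetSum Finset.univ fun k _ => (tendsto_pi_nhds.1 hy k)
    simp only [hsum] at h1
    exact tendsto_nhds_unique h1 tendsto_const_nhds
  convert hy using 2
  funext i
  have hn : (n : ℝ) ≠ 0 := Nat.cast_ne_zero.2 i.pos.ne'
  rw [← hysum, Finset.sum_congr rfl fun k _ => hconst k i (hconn.preconnected k i)]
  simp [hn]
end
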